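/- arXiv:1212.3556 — 6 statements merged into one kernel-verified Lean document; each statement's English description precedes it below -/
import Mathlib

section
/- Let q ≥ 1, let a ∈ ℝ^q and let B be an invertible q×q real matrix, and let T : ℝ^q → ℝ^q be the affine bijection T(x) = a + Bx. Let X ⊆ ℝ^q be a compact set and Z = T(X). Let Θ₂ and Γ₂ be nonempty parameter sets with a bijection g : Θ₂ ≃ Γ₂, and let I_X : ℝ^q → Θ₂ → ℝ and I_Z : ℝ^q → Γ₂ → ℝ be functions, measurable and bounded in the first argument for each fixed parameter, satisfying I_X(x, β₂) = I_Z(a + Bx, g(β₂)) for all x ∈ X and β₂ ∈ Θ₂. If a Borel probability measure ξ* with ξ*(X) = 1 maximizes ξ ↦ ⨅_{β₂ ∈ Θ₂} ∫ I_X(x, β₂) dξ(x) over all Borel probability measures ξ with ξ(X) = 1, then the pushforward η* = Measure.map T ξ* satisfies η*(Z) = 1 and maximizes η ↦ ⨅_{γ₂ ∈ Γ₂} ∫ I_Z(z, γ₂) dη(z) over all Borel probability measures η with η(Z) = 1. -/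
open MeasureTheory

/-- The affine bijection `x ↦ a + B x` of `ℝ^q` for an invertible matrix `B`, as a measurable
equivalence. -/
noncomputable def affineMeasurableEquiv {q : ℕ} (a : Fin q → ℝ)
    {B : Matrix (Fin q) (Fin q) ℝ} (hB : IsUnit B) : (Fin q → ℝ) ≃ᵐ (Fin q → ℝ) where
  toFun x := a + B.mulVec x
  invFun z := B⁻¹.mulVec (z - a)
  left_inv x := by
    simp [Matrix.mulVec_mulVec, Matrix.nonsing_inv_mul B ((Matrix.isUnit_iff_isUnit_det B).1 hB)]
  right_inv z := by
    simp [Matrix.mulVec_mulVec, Matrix.mul_nonsing_inv B ((Matrix.isUnit_iff_isUnit_det B).1 hB)]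
  measurable_toFun :=
    (by fun_prop : Continuous fun x : Fin q → ℝ => a + B.mulVec x).measurable
  measurable_invFun :=
    (by fun_prop : Continuous fun z : Fin q → ℝ => B⁻¹.mulVec (z - a)).measurable

/-- A measurable reparametrization of the design region together with a bijective
reparametrization of the model preserves the KL-criterion of every design. -/
theorem iInf_integral_map_equiv {α β ι κ : Type*} [MeasurableSpace α] [MeasurableSpace β]
    (e : α ≃ᵐ β) (g : ι ≃ κ) {X : Set α} (hX : MeasurableSet X)
    {f : α → ι → ℝ} {h : β → κ → ℝ} (hfh : ∀ x ∈ X, ∀ i, f x i = h (e x) (g i))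
    (μ : Measure α) [IsProbabilityMeasure μ] (hμ : μ X = 1) :
    ⨅ k, ∫ z, h z k ∂(μ.map e) = ⨅ i, ∫ x, f x i ∂μ := by
  rw [← g.iInf_comp]
  refine iInf_congr fun i => ?_
  rw [integral_map_equiv]
  refine integral_congr_ae ?_
  filter_upwards [(mem_ae_iff_prob_eq_one hX).2 hμ] with x hx
  exact (hfh x hx i).symm

/-- invariance of KL-optimum designs under a scale-position transformation
`z = a + B x` of the design region (Theorem 1 of the paper): if `ξ*` is KL-optimum on `X`,
then its pushforward under `T : x ↦ a + B x` is KL-optimum on `Z = T '' X`. -/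
theorem kl_optimum_invariant_affine
    (q : ℕ) (hq : 1 ≤ q)
    (a : Fin q → ℝ) (B : Matrix (Fin q) (Fin q) ℝ) (hB : IsUnit B)
    (X : Set (Fin q → ℝ)) (hX : IsCompact X)
    {Θ₂ Γ₂ : Type*} [Nonempty Θ₂] [Nonempty Γ₂] (g : Θ₂ ≃ Γ₂)
    (IX : (Fin q → ℝ) → Θ₂ → ℝ) (IZ : (Fin q → ℝ) → Γ₂ → ℝ)
    (hIXmeas : ∀ β₂ : Θ₂, Measurable fun x => IX x β₂)
    (hIXbd : ∀ β₂ : Θ₂, ∃ C : ℝ, ∀ x, |IX x β₂| ≤ C)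
    (hIZmeas : ∀ γ₂ : Γ₂, Measurable fun z => IZ z γ₂)
    (hIZbd : ∀ γ₂ : Γ₂, ∃ C : ℝ, ∀ z, |IZ z γ₂| ≤ C)
    (hcomp : ∀ x ∈ X, ∀ β₂ : Θ₂, IX x β₂ = IZ (a + B.mulVec x) (g β₂))
    (ξstar : Measure (Fin q → ℝ)) [IsProbabilityMeasure ξstar] (hξstar : ξstar X = 1)
    (hopt : ∀ ξ : Measure (Fin q → ℝ), IsProbabilityMeasure ξ → ξ X = 1 →
      (⨅ β₂ : Θ₂, ∫ x, IX x β₂ ∂ξ) ≤ ⨅ β₂ : Θ₂, ∫ x, IX x β₂ ∂ξstar) :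
    (Measure.map (fun x => a + B.mulVec x) ξstar) ((fun x => a + B.mulVec x) '' X) = 1 ∧
    ∀ η : Measure (Fin q → ℝ), IsProbabilityMeasure η →
      η ((fun x => a + B.mulVec x) '' X) = 1 →
      (⨅ γ₂ : Γ₂, ∫ z, IZ z γ₂ ∂η) ≤
        ⨅ γ₂ : Γ₂, ∫ z, IZ z γ₂ ∂(Measure.map (fun x => a + B.mulVec x) ξstar) := by
  set e := affineMeasurableEquiv a hB
  change ξstar.map e (e '' X) = 1 ∧ ∀ η : Measure (Fin q → ℝ), IsProbabilityMeasure η →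
    η (e '' X) = 1 → (⨅ γ₂ : Γ₂, ∫ z, IZ z γ₂ ∂η) ≤ ⨅ γ₂ : Γ₂, ∫ z, IZ z γ₂ ∂(ξstar.map e)
  have hcrit := iInf_integral_map_equiv e g hX.measurableSet hcomp
  refine ⟨by rw [e.map_apply, e.injective.preimage_image, hξstar], fun η hη hηZ => ?_⟩
  have hξ : IsProbabilityMeasure (η.map e.symm) :=
    Measure.isProbabilityMeasure_map e.symm.measurable.aemeasurable
  have hξX : η.map e.symm X = 1 := by
    rw [e.symm.map_apply, ← e.image_eq_preimage_symm, hηZ]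
  have hη_eq := hcrit (η.map e.symm) hξX
  rw [e.map_map_symm] at hη_eq
  rw [hη_eq, hcrit ξstar hξstar]
  exact hopt _ hξ hξX
end

section
/- Let X be a compact metric space and let F be a nonempty family of functions f : X → ℝ such that there exist constants M ≥ 0 and L ≥ 0 with 0 ≤ f(x) ≤ M for all f ∈ F and x ∈ X, and every f ∈ F is Lipschitz with constant L. Then the KL-criterion map ξ ↦ ⨅_{f ∈ F} ∫_X f dξ is continuous on the space of Borel probability measures on X equipped with the topology of weak convergence. -/
open MeasureTheory

open scoped BoundedContinuousFunction

/-- The infimum of the integrals of a totally bounded family of bounded continuous functions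
depends continuously on the probability measure. -/
theorem TotallyBounded.continuous_iInf_integral {X : Type*} [TopologicalSpace X]
    [MeasurableSpace X] [OpensMeasurableSpace X] {A : Set (X →ᵇ ℝ)}
    (hA : TotallyBounded A) (hne : A.Nonempty) :
    Continuous fun ξ : ProbabilityMeasure X => ⨅ g : A, ∫ x, (g : X →ᵇ ℝ) x ∂(ξ : Measure X) := by
  have : Nonempty A := hne.to_subtype
  obtain ⟨C, hC⟩ := hA.isBounded.exists_norm_le
  have hbdd (ξ : ProbabilityMeasure X) :
      BddBelow (Set.range fun g : A => ∫ x, (g : X →ᵇ ℝ) x ∂(ξ : Measure X)) := by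
    refine ⟨-C, ?_⟩
    rintro _ ⟨g, rfl⟩
    have := (g : X →ᵇ ℝ).norm_integral_le_norm (ξ : Measure X)
    exact (abs_le.1 (this.trans (hC g g.2))).1
  refine continuous_of_uniform_approx_of_continuous fun u hu => ?_
  obtain ⟨ε, hε, hεu⟩ := Metric.mem_uniformity_dist.1 hu
  obtain ⟨t, htA, htfin, hcover⟩ := Metric.finite_approx_of_totallyBounded hA (ε / 2) (half_pos hε)
  have ht : htfin.toFinset.Nonempty := by
    obtain ⟨g, hg⟩ := hne
    obtain ⟨y, hy, -⟩ := Set.mem_iUnion₂.1 (hcover hg)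
    exact ⟨y, htfin.mem_toFinset.2 hy⟩
  refine ⟨fun ξ => htfin.toFinset.inf' ht fun g => ∫ x, g x ∂(ξ : Measure X),
    Continuous.finset_inf'_apply ht fun g _ =>
      ProbabilityMeasure.continuous_integral_boundedContinuousFunction g, fun ξ => hεu ?_⟩
  have hle : ⨅ g : A, ∫ x, (g : X →ᵇ ℝ) x ∂(ξ : Measure X) ≤
      htfin.toFinset.inf' ht fun g => ∫ x, g x ∂(ξ : Measure X) :=
    Finset.le_inf' _ _ fun g hg => ciInf_le (hbdd ξ) ⟨g, htA (htfin.mem_toFinset.1 hg)⟩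
  have hge : (htfin.toFinset.inf' ht fun g => ∫ x, g x ∂(ξ : Measure X)) - ε / 2 ≤
      ⨅ g : A, ∫ x, (g : X →ᵇ ℝ) x ∂(ξ : Measure X) := by
    refine le_ciInf fun g => ?_
    obtain ⟨y, hy, hgy⟩ := Set.mem_iUnion₂.1 (hcover g.2)
    have hinf := Finset.inf'_le (fun g : X →ᵇ ℝ => ∫ x, g x ∂(ξ : Measure X))
      (htfin.mem_toFinset.2 hy)
    have hnorm := ((g : X →ᵇ ℝ) - y).norm_integral_le_norm (ξ : Measure X)
    have hsub : ∫ x, ((g : X →ᵇ ℝ) - y) x ∂(ξ : Measure X) =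
        ∫ x, (g : X →ᵇ ℝ) x ∂(ξ : Measure X) - ∫ x, y x ∂(ξ : Measure X) :=
      integral_sub ((g : X →ᵇ ℝ).integrable _) (y.integrable _)
    rw [hsub, Real.norm_eq_abs, ← dist_eq_norm (g : X →ᵇ ℝ)] at hnorm
    have := (abs_le.1 (hnorm.trans (Metric.mem_ball.1 hgy).le)).1
    linarith
  rw [Real.dist_eq, abs_lt]
  constructor <;> linarith

/-- continuity of the KL-criterion (Theorem 2 of the paper).
On a compact metric space `X`, given a nonempty family `F` of uniformly bounded,
uniformly Lipschitz nonnegative functions, the map `ξ ↦ ⨅_{f ∈ F} ∫ f dξ` is continuous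
on the space of Borel probability measures with the topology of weak convergence. -/
theorem kl_criterion_continuous
    {X : Type*} [MetricSpace X] [CompactSpace X] [MeasurableSpace X] [BorelSpace X]
    (F : Set (X → ℝ)) (hF : F.Nonempty)
    (M L : ℝ) (hM : 0 ≤ M) (hL : 0 ≤ L)
    (hbd : ∀ f ∈ F, ∀ x : X, 0 ≤ f x ∧ f x ≤ M)
    (hlip : ∀ f ∈ F, LipschitzWith (Real.toNNReal L) f) :
    Continuous fun ξ : ProbabilityMeasure X =>
      ⨅ f : F, ∫ x, (f : X → ℝ) x ∂(ξ : Measure X) := by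
  let A : Set (X →ᵇ ℝ) := {g | ⇑g ∈ F}
  have hlift (f : X → ℝ) (hf : f ∈ F) : ∃ g ∈ A, ⇑g = f :=
    ⟨BoundedContinuousFunction.mkOfCompact ⟨f, (hlip f hf).continuous⟩, hf, rfl⟩
  have hA : TotallyBounded A :=
    (BoundedContinuousFunction.arzela_ascoli (Set.Icc 0 M) isCompact_Icc A
      (fun g x hg => hbd g hg x)
      (LipschitzWith.uniformEquicontinuous (fun g : A => ⇑(g : X →ᵇ ℝ)) L.toNNReal
        fun g => hlip _ g.2).equicontinuous).totallyBounded.subset subset_closure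
  have hne : A.Nonempty := by
    obtain ⟨f, hf⟩ := hF
    obtain ⟨g, hg, -⟩ := hlift f hf
    exact ⟨g, hg⟩
  convert hA.continuous_iInf_integral hne using 2 with ξ
  symm
  refine Function.Surjective.iInf_congr (fun g : A => (⟨⇑(g : X →ᵇ ℝ), g.2⟩ : F)) ?_ fun _ => rfl
  rintro ⟨f, hf⟩
  obtain ⟨g, hg, rfl⟩ := hlift f hf
  exact ⟨⟨g, hg⟩, rfl⟩
end

section
/- Let X be a nonempty compact metric space and let F be a nonempty family of bounded continuous functions f : X → ℝ with f ≥ 0 for every f ∈ F. Then a KL-optimum design exists: there is a Borel probability measure ξ* on X such that ⨅_{f ∈ F} ∫_X f dξ* ≥ ⨅_{f ∈ F} ∫_X f dξ for every Borel probability measure ξ on X. -/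
open MeasureTheory

/-- existence of a KL-optimum design on a nonempty compact metric space, for a
nonempty family of nonnegative bounded continuous functions. -/
theorem kl_optimum_design_exists
    {X : Type*} [MetricSpace X] [CompactSpace X] [Nonempty X]
    [MeasurableSpace X] [BorelSpace X]
    (F : Set (X → ℝ)) (hF : F.Nonempty)
    (hcont : ∀ f ∈ F, Continuous f)
    (hbd : ∀ f ∈ F, ∃ C : ℝ, ∀ x : X, |f x| ≤ C)
    (hnonneg : ∀ f ∈ F, ∀ x : X, 0 ≤ f x) :
    ∃ ξstar : ProbabilityMeasure X, ∀ ξ : ProbabilityMeasure X,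
      (⨅ f : F, ∫ x, (f : X → ℝ) x ∂(ξ : Measure X)) ≤
        ⨅ f : F, ∫ x, (f : X → ℝ) x ∂(ξstar : Measure X) := by
  have hcts : ∀ f : F, Continuous fun ξ : ProbabilityMeasure X =>
      ∫ x, (f : X → ℝ) x ∂(ξ : Measure X) := fun f =>
    ProbabilityMeasure.continuous_integral_boundedContinuousFunction
      (X := X) (BoundedContinuousFunction.mkOfCompact ⟨(f : X → ℝ), hcont f f.2⟩)
  have husc : UpperSemicontinuous fun ξ : ProbabilityMeasure X =>
      ⨅ f : F, ∫ x, (f : X → ℝ) x ∂(ξ : Measure X) := by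
    refine upperSemicontinuous_ciInf (fun ξ => ⟨0, ?_⟩) fun f => (hcts f).upperSemicontinuous
    rintro _ ⟨f, rfl⟩
    exact integral_nonneg (hnonneg f f.2)
  have : Nonempty (ProbabilityMeasure X) :=
    ⟨⟨Measure.dirac (Classical.arbitrary X), inferInstance⟩⟩
  obtain ⟨ξstar, -, hmax⟩ := (husc.upperSemicontinuousOn Set.univ).exists_isMaxOn
    Set.univ_nonempty isCompact_univ
  exact ⟨ξstar, fun ξ => hmax (Set.mem_univ ξ)⟩
end

section
/- Define I : [0,1] × (0,∞) → ℝ by I(x, b) = 2((2b − 1)x + (1 − b)) if 0 < b ≤ 1 and I(x, b) = (b + 1)·x^b if b > 1. For n ≥ 2 let ξ_n be the uniform probability measure on [0, 1 − 1/n] and let ξ be the uniform probability measure on [0, 1]. Then: (i) ξ_n → ξ weakly (as Borel probability measures on [0,1]); (ii) for every n ≥ 2, ⨅_{b ∈ (0,∞)} ∫_{[0,1]} I(x, b) dξ_n(x) = 0; (iii) ⨅_{b ∈ (0,∞)} ∫_{[0,1]} I(x, b) dξ(x) = 1. In particular, the map ξ ↦ ⨅_{b ∈ (0,∞)} ∫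 I(x, b) dξ(x) is not continuous with respect to weak convergence of probability measures. -/
open MeasureTheory Filter

/-- The family of divergences of the paper's counterexample:
`I(x, b) = 2((2b − 1)x + (1 − b))` for `0 < b ≤ 1` and `I(x, b) = (b + 1)·x^b` for `b > 1`. -/
noncomputable def klCounterexample (x b : ℝ) : ℝ :=
  if b ≤ 1 then 2 * ((2 * b - 1) * x + (1 - b)) else (b + 1) * Real.rpow x b

/-- The uniform probability measure on `[0, c]`. -/
noncomputable def unifIcc (c : ℝ) : Measure ℝ :=
  (ENNReal.ofReal c)⁻¹ • volume.restrict (Set.Icc 0 c)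

theorem integral_unifIcc {c : ℝ} (hc : 0 ≤ c) (f : ℝ → ℝ) :
    ∫ x, f x ∂(unifIcc c) = c⁻¹ * ∫ x in (0 : ℝ)..c, f x := by
  rw [unifIcc, integral_smul_measure, intervalIntegral.integral_of_le hc,
    integral_Icc_eq_integral_Ioc, ENNReal.toReal_inv, ENNReal.toReal_ofReal hc, smul_eq_mul]

theorem tendsto_integral_unifIcc {h : ℝ → ℝ} (hh : Continuous h) {u : ℕ → ℝ} {c : ℝ}
    (hu : ∀ n, 0 ≤ u n) (hc : 0 < c) (huc : Tendsto u atTop (nhds c)) :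
    Tendsto (fun n => ∫ x, h x ∂(unifIcc (u n))) atTop (nhds (∫ x, h x ∂(unifIcc c))) := by
  simp only [integral_unifIcc hc.le, integral_unifIcc (hu _)]
  have hcont : Continuous fun t : ℝ => ∫ x in (0 : ℝ)..t, h x :=
    intervalIntegral.continuous_primitive (fun a b => hh.intervalIntegrable a b) 0
  exact (huc.inv₀ hc.ne').mul ((hcont.tendsto c).comp huc)

theorem integral_klCounterexample_of_le_one {b c : ℝ} (hb : b ≤ 1) (hc : 0 < c) :
    ∫ x, klCounterexample x b ∂(unifIcc c) = c + 2 * (1 - b) * (1 - c) := by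
  rw [integral_unifIcc hc.le]
  simp only [klCounterexample, if_pos hb]
  rw [intervalIntegral.integral_const_mul, intervalIntegral.integral_add
    (Continuous.intervalIntegrable (by fun_prop) _ _) (by simp),
    intervalIntegral.integral_const_mul, integral_id, intervalIntegral.integral_const]
  simp only [smul_eq_mul]
  field_simp
  ring

theorem integral_klCounterexample_of_one_lt {b c : ℝ} (hb : 1 < b) (hc : 0 < c) :
    ∫ x, klCounterexample x b ∂(unifIcc c) = c ^ b := by
  rw [integral_unifIcc hc.le]
  simp only [klCounterexample, if_neg hb.not_ge, Real.rpow_eq_pow]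
  rw [intervalIntegral.integral_const_mul, integral_rpow (Or.inl (by linarith)),
    Real.zero_rpow (by linarith), Real.rpow_add_one hc.ne']
  have hb' : b + 1 ≠ 0 := by linarith
  field_simp
  ring

theorem iInf_integral_klCounterexample_of_lt_one {c : ℝ} (hc : 0 < c) (hc1 : c < 1) :
    (⨅ b : Set.Ioi (0 : ℝ), ∫ x, klCounterexample x (b : ℝ) ∂(unifIcc c)) = 0 := by
  have : Nonempty (Set.Ioi (0 : ℝ)) := ⟨⟨1, Set.mem_Ioi.2 one_pos⟩⟩
  refine ciInf_eq_of_forall_ge_of_forall_gt_exists_lt (fun b => ?_) (fun w hw => ?_)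
  · rcases le_or_gt (b : ℝ) 1 with hb | hb
    · rw [integral_klCounterexample_of_le_one hb hc]
      have := mul_nonneg (sub_nonneg.2 hb) (sub_nonneg.2 hc1.le)
      linarith
    · rw [integral_klCounterexample_of_one_lt hb hc]
      positivity
  · obtain ⟨b, hbw, hb⟩ := (((tendsto_rpow_atTop_of_base_lt_one c (by linarith) hc1).eventually
      (gt_mem_nhds hw)).and (eventually_gt_atTop 1)).exists
    exact ⟨⟨b, one_pos.trans hb⟩, (integral_klCounterexample_of_one_lt hb hc).trans_lt hbw⟩

theorem integral_klCounterexample_unifIcc_one (b : ℝ) :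
    ∫ x, klCounterexample x b ∂(unifIcc 1) = 1 := by
  rcases le_or_gt b 1 with hb | hb
  · simp [integral_klCounterexample_of_le_one hb one_pos]
  · simp [integral_klCounterexample_of_one_lt hb one_pos]

/-- the paper's counterexample showing that the KL-criterion
`ξ ↦ ⨅_{b > 0} ∫ I(x, b) dξ(x)` need not be continuous with respect to weak convergence:
the uniform designs `ξ_n` on `[0, 1 − 1/n]` converge weakly to the uniform design `ξ` on
`[0,1]`, yet the criterion is `0` at each `ξ_n` while it is `1` at `ξ`. -/
theorem kl_criterion_not_continuous_counterexample :
    (∀ h : ℝ → ℝ, Continuous h → (∃ C : ℝ, ∀ x, |h x| ≤ C) →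
      Tendsto (fun n : ℕ => ∫ x, h x ∂(unifIcc (1 - 1 / (n : ℝ)))) atTop
        (nhds (∫ x, h x ∂(unifIcc 1)))) ∧
    (∀ n : ℕ, 2 ≤ n →
      (⨅ b : Set.Ioi (0 : ℝ), ∫ x, klCounterexample x (b : ℝ)
        ∂(unifIcc (1 - 1 / (n : ℝ)))) = 0) ∧
    (⨅ b : Set.Ioi (0 : ℝ), ∫ x, klCounterexample x (b : ℝ) ∂(unifIcc 1)) = 1 := by
  refine ⟨fun h hh _ => ?_, fun n hn => ?_, ?_⟩
  · refine tendsto_integral_unifIcc hh (fun n => ?_) one_pos ?_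
    · simpa using Nat.cast_inv_le_one (α := ℝ) n
    · simpa using tendsto_one_div_atTop_nhds_zero_nat (𝕜 := ℝ) |>.const_sub 1
  · have hn' : (2 : ℝ) ≤ n := by exact_mod_cast hn
    have hpos : 0 < 1 / (n : ℝ) := by positivity
    have hlt : 1 / (n : ℝ) < 1 := by
      rw [div_lt_one (by linarith)]
      linarith
    exact iInf_integral_klCounterexample_of_lt_one (by linarith) (by linarith)
  · have : Nonempty (Set.Ioi (0 : ℝ)) := ⟨⟨1, Set.mem_Ioi.2 one_pos⟩⟩
    simp only [integral_klCounterexample_unifIcc_one, ciInf_const]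
end

section
/- Define I : [0,1] × (0,∞) → ℝ by I(x, b) = 2((2b − 1)x + (1 − b)) if 0 < b ≤ 1 and I(x, b) = (b + 1)·x^b if b > 1. Then I(x, b) ≥ 0 for all x ∈ [0,1] and b ∈ (0,∞), and for every x ∈ [0,1] one has ⨅_{b ∈ (0,∞)} I(x, b) = 0. -/
theorem klCounterexample_nonneg {x b : ℝ} (hx : x ∈ Set.Icc (0 : ℝ) 1) (hb : 0 < b) :
    0 ≤ klCounterexample x b := by
  obtain ⟨hx0, hx1⟩ := hx
  unfold klCounterexample
  split_ifs with h
  · nlinarith [mul_nonneg hb.le hx0, mul_nonneg (sub_nonneg.2 h) (sub_nonneg.2 hx1)]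
  · exact mul_nonneg (by linarith) (Real.rpow_nonneg hx0 b)

theorem klCounterexample_one_of_le_one {b : ℝ} (hb : b ≤ 1) : klCounterexample 1 b = 2 * b := by
  rw [klCounterexample, if_pos hb]
  ring

theorem klCounterexample_natCast (x : ℝ) {n : ℕ} (hn : 2 ≤ n) :
    klCounterexample x n = (n + 1) * x ^ n := by
  have h : ¬ (n : ℝ) ≤ 1 := by
    rw [Nat.cast_le_one]
    omega
  rw [klCounterexample, if_neg h, Real.rpow_eq_pow, Real.rpow_natCast]

theorem exists_klCounterexample_lt {x ε : ℝ} (hx : x ∈ Set.Icc (0 : ℝ) 1) (hε : 0 < ε) :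
    ∃ b : Set.Ioi (0 : ℝ), klCounterexample x b < ε := by
  obtain ⟨hx0, hx1⟩ := hx
  rcases hx1.eq_or_lt with rfl | hx1
  · refine ⟨⟨min 1 (ε / 4), Set.mem_Ioi.2 (by positivity)⟩, ?_⟩
    rw [klCounterexample_one_of_le_one (min_le_left _ _)]
    linarith [min_le_right 1 (ε / 4)]
  · have h : Filter.Tendsto (fun n : ℕ ↦ (n : ℝ) * x ^ n + x ^ n) Filter.atTop (nhds 0) := by
      simpa using (tendsto_self_mul_const_pow_of_lt_one hx0 hx1).add
        (tendsto_pow_atTop_nhds_zero_of_lt_one hx0 hx1)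
    obtain ⟨n, hn, hn2⟩ :=
      ((h.eventually_lt_const hε).and (Filter.eventually_ge_atTop 2)).exists
    refine ⟨⟨n, Set.mem_Ioi.2 (by positivity)⟩, ?_⟩
    rw [klCounterexample_natCast x hn2]
    linarith

/-- in the paper's counterexample, `I(x, b) ≥ 0` for all `x ∈ [0,1]` and
`b ∈ (0,∞)`, and the KL-criterion of every one-point design vanishes:
`⨅_{b > 0} I(x, b) = 0` for every `x ∈ [0,1]`. -/
theorem klCounterexample_nonneg_and_iInf_eq_zero :
    (∀ x ∈ Set.Icc (0 : ℝ) 1, ∀ b ∈ Set.Ioi (0 : ℝ), 0 ≤ klCounterexample x b) ∧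
    (∀ x ∈ Set.Icc (0 : ℝ) 1,
      (⨅ b : Set.Ioi (0 : ℝ), klCounterexample x (b : ℝ)) = 0) := by
  refine ⟨fun x hx b hb ↦ klCounterexample_nonneg hx hb, fun x hx ↦ ?_⟩
  have : Nonempty (Set.Ioi (0 : ℝ)) := ⟨⟨1, Set.mem_Ioi.2 one_pos⟩⟩
  exact ciInf_eq_of_forall_ge_of_forall_gt_exists_lt
    (fun b ↦ klCounterexample_nonneg hx b.2) fun _ hε ↦ exists_klCounterexample_lt hx hε
end

section
/- Let ξ̃ be the discrete probability measure on [−1,1] assigning mass 1/6 to −1, 1/3 to −1/2, 1/3 to 1/2, and 1/6 to 1. Then for every (θ₀, θ₁, θ₂) ∈ ℝ³, ∫_{[−1,1]} (θ₀ + θ₁x + θ₂x² + x³)² dξ̃(x) ≥ 1/16, with equality for (θ₀, θ₁, θ₂) = (0, −3/4, 0); hence ⨅_{θ ∈ ℝ³} ∫ (θ₀ + θ₁x + θ₂x² + x³)² dξ̃(x) = 1/16, and ξ̃ maximizes the map ξ ↦ ⨅_{θ ∈ ℝ³} ∫ (θ₀ + θ₁x + θ₂x² + x³)² dξ(x) over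 all Borel probability measures ξ on [−1,1]. -/
open MeasureTheory
open scoped ENNReal

/-- The design `ξ̃` supported on `{−1, −1/2, 1/2, 1}` with weights `1/6, 1/3, 1/3, 1/6`. -/
noncomputable def chebDesign : Measure ℝ :=
  (1 / 6 : ℝ≥0∞) • Measure.dirac (-1) + (1 / 3 : ℝ≥0∞) • Measure.dirac (-1 / 2) +
    (1 / 3 : ℝ≥0∞) • Measure.dirac (1 / 2) + (1 / 6 : ℝ≥0∞) • Measure.dirac 1

theorem integral_chebDesign (f : ℝ → ℝ) :
    ∫ x, f x ∂chebDesign =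
      1 / 6 * f (-1) + 1 / 3 * f (-1 / 2) + 1 / 3 * f (1 / 2) + 1 / 6 * f 1 := by
  have h (c : ℝ≥0∞) (hc : c ≠ ∞) (a : ℝ) : Integrable f (c • Measure.dirac a) :=
    (integrable_dirac enorm_lt_top).smul_measure hc
  have h₆ : (1 / 6 : ℝ≥0∞) ≠ ∞ := by simp
  have h₃ : (1 / 3 : ℝ≥0∞) ≠ ∞ := by simp
  rw [chebDesign,
    integral_add_measure (((h _ h₆ _).add_measure (h _ h₃ _)).add_measure (h _ h₃ _)) (h _ h₆ _),
    integral_add_measure ((h _ h₆ _).add_measure (h _ h₃ _)) (h _ h₃ _),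
    integral_add_measure (h _ h₆ _) (h _ h₃ _)]
  simp [integral_smul_measure]

theorem sq_cube_sub_le {x : ℝ} (hx : x ∈ Set.Icc (-1 : ℝ) 1) :
    ((0 : ℝ) + (-3 / 4) * x + (0 : ℝ) * x ^ 2 + x ^ 3) ^ 2 ≤ 1 / 16 := by
  have hx2 : 0 ≤ 1 - x ^ 2 := by nlinarith [hx.1, hx.2]
  have key : 1 / 16 - ((0 : ℝ) + (-3 / 4) * x + (0 : ℝ) * x ^ 2 + x ^ 3) ^ 2 =
      (1 - x ^ 2) * (x ^ 2 - 1 / 4) ^ 2 := by ring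
  linarith [mul_nonneg hx2 (sq_nonneg (x ^ 2 - 1 / 4))]

theorem integral_sq_cube_sub_le (ξ : Measure ℝ) [IsProbabilityMeasure ξ]
    (hξ : ξ (Set.Icc (-1 : ℝ) 1) = 1) :
    ∫ x, ((0 : ℝ) + (-3 / 4) * x + (0 : ℝ) * x ^ 2 + x ^ 3) ^ 2 ∂ξ ≤ 1 / 16 := by
  have hae : ∀ᵐ x ∂ξ, x ∈ Set.Icc (-1 : ℝ) 1 :=
    (mem_ae_iff_prob_eq_one measurableSet_Icc).2 hξ
  calc ∫ x, ((0 : ℝ) + (-3 / 4) * x + (0 : ℝ) * x ^ 2 + x ^ 3) ^ 2 ∂ξ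
      ≤ ∫ _, (1 / 16 : ℝ) ∂ξ :=
        integral_mono_of_nonneg (ae_of_all _ fun _ ↦ sq_nonneg _) (integrable_const _)
          (hae.mono fun _ hx ↦ sq_cube_sub_le hx)
    _ = 1 / 16 := by simp

/-- the benchmark design `ξ̃` is KL-optimum: every quadratic correction gives
`∫ (θ₀ + θ₁x + θ₂x² + x³)² dξ̃ ≥ 1/16`, with equality at `θ = (0, −3/4, 0)`; hence the
KL-criterion of `ξ̃` equals `1/16`, and `ξ̃` maximizes the KL-criterion over all Borel
probability measures on `[−1, 1]`. -/
theorem chebDesign_kl_optimum :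
    (∀ θ : ℝ × ℝ × ℝ,
      (1 : ℝ) / 16 ≤ ∫ x, (θ.1 + θ.2.1 * x + θ.2.2 * x ^ 2 + x ^ 3) ^ 2 ∂chebDesign) ∧
    (∫ x, ((0 : ℝ) + (-3 / 4) * x + (0 : ℝ) * x ^ 2 + x ^ 3) ^ 2 ∂chebDesign = 1 / 16) ∧
    ((⨅ θ : ℝ × ℝ × ℝ,
      ∫ x, (θ.1 + θ.2.1 * x + θ.2.2 * x ^ 2 + x ^ 3) ^ 2 ∂chebDesign) = 1 / 16) ∧
    (∀ ξ : Measure ℝ, IsProbabilityMeasure ξ → ξ (Set.Icc (-1 : ℝ) 1) = 1 →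
      (⨅ θ : ℝ × ℝ × ℝ, ∫ x, (θ.1 + θ.2.1 * x + θ.2.2 * x ^ 2 + x ^ 3) ^ 2 ∂ξ) ≤
        ⨅ θ : ℝ × ℝ × ℝ,
          ∫ x, (θ.1 + θ.2.1 * x + θ.2.2 * x ^ 2 + x ^ 3) ^ 2 ∂chebDesign) := by
  have lower (θ : ℝ × ℝ × ℝ) :
      (1 : ℝ) / 16 ≤ ∫ x, (θ.1 + θ.2.1 * x + θ.2.2 * x ^ 2 + x ^ 3) ^ 2 ∂chebDesign := by
    rw [integral_chebDesign]
    nlinarith [sq_nonneg (θ.2.1 + 3 / 4), sq_nonneg (θ.1 + θ.2.2), sq_nonneg (θ.1 + θ.2.2 / 4)]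
  have attained :
      ∫ x, ((0 : ℝ) + (-3 / 4) * x + (0 : ℝ) * x ^ 2 + x ^ 3) ^ 2 ∂chebDesign = 1 / 16 := by
    rw [integral_chebDesign]
    norm_num
  have iInf_le (ξ : Measure ℝ) :
      (⨅ θ : ℝ × ℝ × ℝ, ∫ x, (θ.1 + θ.2.1 * x + θ.2.2 * x ^ 2 + x ^ 3) ^ 2 ∂ξ) ≤
        ∫ x, ((0 : ℝ) + (-3 / 4) * x + (0 : ℝ) * x ^ 2 + x ^ 3) ^ 2 ∂ξ :=
    ciInf_le ⟨0, Set.forall_mem_range.2 fun _ ↦ integral_nonneg fun _ ↦ sq_nonneg _⟩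
      ((0, -3 / 4, 0) : ℝ × ℝ × ℝ)
  refine ⟨lower, attained, le_antisymm ((iInf_le _).trans_eq attained) (le_ciInf lower), ?_⟩
  intro ξ _ hξ
  exact ((iInf_le ξ).trans (integral_sq_cube_sub_le ξ hξ)).trans (le_ciInf lower)
end
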